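/- Let σ be an absolutely continuous probability measure on ℝⁿ with finite second moment, let T : ℝⁿ → ℝⁿ be a measurable map with ∫ ‖T(x)‖² dσ(x) < ∞, and set μ = T_♯σ. Then for every P ∈ O(n), (∫ ‖T(x) − T_{σ,μ;P}(x)‖² dσ(x))^{1/2} ≤ 2 · inf{ (∫ ‖T(x) − ax − b‖² dσ(x))^{1/2} : a > 0, b ∈ ℝⁿ }. -/

import Mathlib

open MeasureTheory Filter
open scoped ENNReal RealInnerProductSpace BigOperators Topology

noncomputable section

namespace SliceMatching

/-- `ℝⁿ` with its Euclidean structure. -/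
abbrev Rn (n : ℕ) := EuclideanSpace ℝ (Fin n)

/-- The cumulative distribution function of a measure on `ℝ`. -/
def cdf (ν : Measure ℝ) (t : ℝ) : ℝ := (ν (Set.Iic t)).toReal

/-- The quantile function (pseudo-inverse of the CDF) of a measure on `ℝ`. -/
def quantile (ρ : Measure ℝ) (p : ℝ) : ℝ := sInf {t : ℝ | p ≤ cdf ρ t}

/-- The one-dimensional optimal transport map `T_ν^ρ = F_ρ⁻¹ ∘ F_ν`. -/
def otMap1d (ν ρ : Measure ℝ) (t : ℝ) : ℝ := quantile ρ (cdf ν t)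

/-- The slice `σ^θ`: pushforward of `σ` under the projection `x ↦ ⟪x, θ⟫`. -/
def slice {n : ℕ} (σ : Measure (Rn n)) (θ : Rn n) : Measure ℝ :=
  σ.map (fun x => ⟪x, θ⟫)

/-- The matrix-slice matching map `T_{σ,μ;P}`, where `P ∈ O(n)` has columns `θ 0, …, θ (n-1)`:
`T_{σ,μ;P}(x) = ∑ i, T_{σ^{θ i}}^{μ^{θ i}}(⟪x, θ i⟫) • θ i`. -/
def smMap {n : ℕ} (σ μ : Measure (Rn n)) (θ : Fin n → Rn n) (x : Rn n) : Rn n :=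
  ∑ i, otMap1d (slice σ (θ i)) (slice μ (θ i)) ⟪x, θ i⟫ • θ i

/-- The squared quadratic Wasserstein distance: the infimum of `∫ ‖x - y‖²` over all
couplings of `σ` and `μ`. -/
def W2sq {α : Type*} [MeasurableSpace α] [NormedAddCommGroup α] (σ μ : Measure α) : ℝ :=
  (⨅ (π : Measure (α × α)) (_ : π.map Prod.fst = σ ∧ π.map Prod.snd = μ),
    ∫⁻ p, ENNReal.ofReal (‖p.1 - p.2‖ ^ 2) ∂π).toReal

/-- The quadratic Wasserstein distance `W₂`. -/
def W2 {α : Type*} [MeasurableSpace α] [NormedAddCommGroup α] (σ μ : Measure α) : ℝ :=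
  Real.sqrt (W2sq σ μ)

/-- `(x - y)²` is the area of the square with side the interval between `x` and `y`. -/
lemma ofReal_sub_sq (x y : ℝ) :
    ENNReal.ofReal ((x - y) ^ 2) =
      (volume : Measure (ℝ × ℝ)) (Set.Ico x y ×ˢ Set.Ico x y) +
        (volume : Measure (ℝ × ℝ)) (Set.Ico y x ×ˢ Set.Ico y x) := by
  rw [Measure.volume_eq_prod, Measure.prod_prod, Measure.prod_prod, Real.volume_Ico,
    Real.volume_Ico]
  rcases le_total x y with h | h
  · rw [ENNReal.ofReal_of_nonpos (sub_nonpos.2 h), ← ENNReal.ofReal_mul (sub_nonneg.2 h)]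
    simp only [mul_zero, add_zero]
    ring_nf
  · rw [ENNReal.ofReal_of_nonpos (sub_nonpos.2 h), ← ENNReal.ofReal_mul (sub_nonneg.2 h)]
    simp only [mul_zero, zero_add]
    ring_nf

variable {Ω : Type*} [MeasurableSpace Ω]

lemma lintegral_volume_Ico_prod (P : Measure Ω) [IsProbabilityMeasure P] {X Y : Ω → ℝ}
    (hX : Measurable X) (hY : Measurable Y) :
    ∫⁻ ω, (volume : Measure (ℝ × ℝ)) (Set.Ico (X ω) (Y ω) ×ˢ Set.Ico (X ω) (Y ω)) ∂P =
      ∫⁻ p : ℝ × ℝ, P ({ω | X ω ≤ min p.1 p.2} \ {ω | Y ω ≤ max p.1 p.2}) := by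
  let S : Set (Ω × (ℝ × ℝ)) :=
    {q | X q.1 ≤ min q.2.1 q.2.2} \ {q | Y q.1 ≤ max q.2.1 q.2.2}
  have hS : MeasurableSet S :=
    (measurableSet_le (by fun_prop) (by fun_prop)).diff
      (measurableSet_le (by fun_prop) (by fun_prop))
  have h₁ := Measure.prod_apply (μ := P) (ν := (volume : Measure (ℝ × ℝ))) hS
  have h₂ := Measure.prod_apply_symm (μ := P) (ν := (volume : Measure (ℝ × ℝ))) hS
  rw [h₁] at h₂
  convert h₂ using 4 with ω p
  · ext p
    simp only [S, Set.mem_prod, Set.mem_Ico, Set.mem_preimage, Set.mem_sdiff, Set.mem_ofPred_eq,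
      le_min_iff, not_le, max_lt_iff]
    tauto
  · rfl

lemma lintegral_ofReal_sub_sq (P : Measure Ω) [IsProbabilityMeasure P] {X Y : Ω → ℝ}
    (hX : Measurable X) (hY : Measurable Y) :
    ∫⁻ ω, ENNReal.ofReal ((X ω - Y ω) ^ 2) ∂P =
      (∫⁻ p : ℝ × ℝ, P ({ω | X ω ≤ min p.1 p.2} \ {ω | Y ω ≤ max p.1 p.2})) +
        ∫⁻ p : ℝ × ℝ, P ({ω | Y ω ≤ min p.1 p.2} \ {ω | X ω ≤ max p.1 p.2}) := by
  rw [← lintegral_volume_Ico_prod P hX hY, ← lintegral_volume_Ico_prod P hY hX]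
  simp_rw [ofReal_sub_sq]
  refine lintegral_add_left ?_ _
  simp_rw [Measure.volume_eq_prod, Measure.prod_prod, Real.volume_Ico]
  fun_prop

/-- Among all `Y` with a given distribution function, the one comonotone with `U` minimizes
the quadratic cost. -/
lemma lintegral_sub_sq_le_of_comonotone (P : Measure Ω) [IsProbabilityMeasure P] {U V Y : Ω → ℝ}
    (hU : Measurable U) (hV : Measurable V) (hY : Measurable Y)
    (hUV : ∀ s t, P ({ω | U ω ≤ s} \ {ω | V ω ≤ t}) ≤ P {ω | U ω ≤ s} - P {ω | V ω ≤ t})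
    (hVU : ∀ s t, P ({ω | V ω ≤ s} \ {ω | U ω ≤ t}) ≤ P {ω | V ω ≤ s} - P {ω | U ω ≤ t})
    (hVY : ∀ t, P {ω | V ω ≤ t} = P {ω | Y ω ≤ t}) :
    ∫⁻ ω, ENNReal.ofReal ((U ω - V ω) ^ 2) ∂P ≤ ∫⁻ ω, ENNReal.ofReal ((U ω - Y ω) ^ 2) ∂P := by
  rw [lintegral_ofReal_sub_sq P hU hV, lintegral_ofReal_sub_sq P hU hY]
  refine add_le_add (lintegral_mono fun p => ?_) (lintegral_mono fun p => ?_)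
  · exact (hUV _ _).trans (by rw [hVY]; exact le_measure_sdiff)
  · exact (hVU _ _).trans (by rw [hVY]; exact le_measure_sdiff)

lemma measure_diff_le_of_isLowerSet (P : Measure Ω) [IsProbabilityMeasure P] {X : Ω → ℝ}
    (hX : Measurable X) {A B : Set ℝ} (hA : IsLowerSet A) (hB : IsLowerSet B) :
    P (X ⁻¹' A \ X ⁻¹' B) ≤ P (X ⁻¹' A) - P (X ⁻¹' B) := by
  rcases hA.total hB with h | h
  · simp [Set.sdiff_eq_empty.2 (Set.preimage_mono (f := X) h)]
  · exact (measure_sdiff (Set.preimage_mono h)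
      (hX hB.ordConnected.measurableSet).nullMeasurableSet (measure_ne_top _ _)).le

section Cdf

variable (ν : Measure ℝ) [IsProbabilityMeasure ν]

lemma cdf_eq_probabilityTheory_cdf (t : ℝ) : cdf ν t = ProbabilityTheory.cdf ν t := by
  rw [ProbabilityTheory.cdf_eq_real]
  rfl

lemma monotone_cdf : Monotone (cdf ν) := fun s t h => by
  simpa only [cdf_eq_probabilityTheory_cdf] using ProbabilityTheory.monotone_cdf ν h

lemma continuous_cdf [NullSingletonClass ν] : Continuous (cdf ν) := by
  have h : cdf ν = ProbabilityTheory.cdf ν := funext (cdf_eq_probabilityTheory_cdf ν)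
  rw [h, continuous_iff_continuousAt]
  intro t
  rw [(ProbabilityTheory.monotone_cdf ν).continuousAt_iff_leftLim_eq_rightLim,
    StieltjesFunction.rightLim_eq]
  refine le_antisymm ((ProbabilityTheory.monotone_cdf ν).leftLim_le le_rfl) ?_
  have := (ProbabilityTheory.cdf ν).measure_singleton t
  rw [ProbabilityTheory.measure_cdf, measure_singleton, eq_comm, ENNReal.ofReal_eq_zero] at this
  linarith

lemma exists_cdf_eq [NullSingletonClass ν] {q : ℝ} (hq : q ∈ Set.Ioo 0 1) : ∃ t, cdf ν t = q := by
  have h : cdf ν = ProbabilityTheory.cdf ν := funext (cdf_eq_probabilityTheory_cdf ν)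
  obtain ⟨s, hs⟩ := ((ProbabilityTheory.tendsto_cdf_atBot ν).eventually_lt_const hq.1).exists
  obtain ⟨t, ht⟩ := ((ProbabilityTheory.tendsto_cdf_atTop ν).eventually_const_lt hq.2).exists
  rw [← h] at hs ht
  exact mem_range_of_exists_le_of_exists_ge (continuous_cdf ν) ⟨s, hs.le⟩ ⟨t, ht.le⟩

lemma measure_Iic_eq_ofReal_cdf (t : ℝ) : ν (Set.Iic t) = ENNReal.ofReal (cdf ν t) :=
  (ENNReal.ofReal_toReal (measure_ne_top _ _)).symm

/-- The probability integral transform: the distribution function of an atomless law is uniformly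
distributed on the unit interval. -/
lemma measure_cdf_le [NullSingletonClass ν] {q : ℝ} (hq : q ∈ Set.Icc 0 1) :
    ν {x | cdf ν x ≤ q} = ENNReal.ofReal q := by
  apply le_antisymm
  · rcases hq.2.eq_or_lt with rfl | hq1
    · simpa using prob_le_one
    · have hev : ∀ᶠ r in 𝓝[>] q, ν {x | cdf ν x ≤ q} ≤ ENNReal.ofReal r := by
        filter_upwards [Ioo_mem_nhdsGT hq1] with r hr
        obtain ⟨t, ht⟩ := exists_cdf_eq ν ⟨hq.1.trans_lt hr.1, hr.2⟩
        rw [← ht, ← measure_Iic_eq_ofReal_cdf]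
        refine measure_mono fun x hx => ?_
        by_contra hxt
        have := monotone_cdf ν (not_le.1 hxt).le
        have hx' : cdf ν x ≤ q := hx
        linarith [hr.1]
      exact ge_of_tendsto
        ((ENNReal.continuous_ofReal.tendsto q).mono_left nhdsWithin_le_nhds) hev
  · rcases hq.2.eq_or_lt with rfl | hq1
    · have : {x | cdf ν x ≤ 1} = Set.univ := Set.eq_univ_of_forall fun x => by
        simpa only [Set.mem_ofPred_eq, cdf_eq_probabilityTheory_cdf]
          using ProbabilityTheory.cdf_le_one ν x
      simp [this]
    rcases hq.1.eq_or_lt with rfl | hq0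
    · simp
    obtain ⟨t, ht⟩ := exists_cdf_eq ν ⟨hq0, hq1⟩
    rw [← ht, ← measure_Iic_eq_ofReal_cdf]
    exact measure_mono fun x hx => monotone_cdf ν hx

lemma ae_cdf_mem_Ioo [NullSingletonClass ν] : ∀ᵐ x ∂ν, cdf ν x ∈ Set.Ioo 0 1 := by
  have h0 : ∀ᵐ x ∂ν, 0 < cdf ν x := by
    rw [ae_iff]
    simpa using measure_cdf_le ν (q := 0) (by simp)
  have h1 : ∀ᵐ x ∂ν, cdf ν x < 1 := by
    have hm : MeasurableSet {x | cdf ν x < 1} := (monotone_cdf ν).measurable measurableSet_Iio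
    rw [ae_iff, ← Set.compl_ofPred, prob_compl_eq_zero_iff hm]
    refine le_antisymm prob_le_one ?_
    have hev : ∀ᶠ r in 𝓝[<] (1 : ℝ), ENNReal.ofReal r ≤ ν {x | cdf ν x < 1} := by
      filter_upwards [Ioo_mem_nhdsLT (zero_lt_one' ℝ)] with r hr
      rw [← measure_cdf_le ν ⟨hr.1.le, hr.2.le⟩]
      exact measure_mono fun x hx => lt_of_le_of_lt hx hr.2
    rw [← ENNReal.ofReal_one]
    exact le_of_tendsto
      ((ENNReal.continuous_ofReal.tendsto 1).mono_left nhdsWithin_le_nhds) hev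
  filter_upwards [h0, h1] with x h h' using ⟨h, h'⟩

lemma quantile_le_iff {p : ℝ} (hp : p ∈ Set.Ioo 0 1) (t : ℝ) :
    quantile ν p ≤ t ↔ p ≤ cdf ν t := by
  have h : cdf ν = ProbabilityTheory.cdf ν := funext (cdf_eq_probabilityTheory_cdf ν)
  have hbdd : BddBelow {t : ℝ | p ≤ cdf ν t} := by
    obtain ⟨s, hs⟩ := ((ProbabilityTheory.tendsto_cdf_atBot ν).eventually_lt_const hp.1).exists
    rw [← h] at hs
    refine ⟨s, fun u hu => ?_⟩
    by_contra hus
    have := monotone_cdf ν (not_le.1 hus).le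
    have hu' : p ≤ cdf ν u := hu
    linarith
  refine ⟨fun hle => ?_, fun hle => csInf_le hbdd hle⟩
  have hne : {t : ℝ | p ≤ cdf ν t}.Nonempty := by
    obtain ⟨s, hs⟩ := ((ProbabilityTheory.tendsto_cdf_atTop ν).eventually_const_lt hp.2).exists
    rw [← h] at hs
    exact ⟨s, hs.le⟩
  have hev : ∀ᶠ r in 𝓝[>] t, p ≤ cdf ν r := by
    filter_upwards [self_mem_nhdsWithin] with r hr
    obtain ⟨u, hu, hur⟩ := exists_lt_of_csInf_lt hne (hle.trans_lt hr)
    exact le_trans hu (monotone_cdf ν hur.le)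
  have hright : Tendsto (cdf ν) (𝓝[>] t) (𝓝 (cdf ν t)) := by
    rw [h]
    exact ((ProbabilityTheory.cdf ν).right_continuous t).mono_left
      (nhdsWithin_mono _ Set.Ioi_subset_Ici_self)
  exact ge_of_tendsto hright hev

end Cdf

lemma ae_otMap1d_le_iff (ν ρ : Measure ℝ) [IsProbabilityMeasure ν] [IsProbabilityMeasure ρ]
    [NullSingletonClass ν] : ∀ᵐ x ∂ν, ∀ t, otMap1d ν ρ x ≤ t ↔ cdf ν x ≤ cdf ρ t := by
  filter_upwards [ae_cdf_mem_Ioo ν] with x hx t using quantile_le_iff ρ hx t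

lemma aemeasurable_otMap1d (ν ρ : Measure ℝ) [IsProbabilityMeasure ν] [IsProbabilityMeasure ρ]
    [NullSingletonClass ν] : AEMeasurable (otMap1d ν ρ) ν := by
  have hF : Measurable (cdf ν) := (monotone_cdf ν).measurable
  have hmono : MonotoneOn (quantile ρ) (Set.Ioo 0 1) := fun p hp q hq hpq =>
    (quantile_le_iff ρ hp _).2 (hpq.trans ((quantile_le_iff ρ hq _).1 le_rfl))
  have h := aemeasurable_restrict_of_monotoneOn (μ := ν.map (cdf ν)) measurableSet_Ioo hmono
  have hmem : ∀ᵐ p ∂ν.map (cdf ν), p ∈ Set.Ioo (0 : ℝ) 1 :=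
    (ae_map_iff hF.aemeasurable measurableSet_Ioo).2 (ae_cdf_mem_Ioo ν)
  rw [Measure.restrict_eq_self_of_ae_mem hmem] at h
  exact h.comp_measurable hF

/-- The one-dimensional optimal transport map is the best coupling of an increasing affine
function of `X` with the law of `Y`. -/
lemma lintegral_affine_sub_otMap1d_sq_le (P : Measure Ω) [IsProbabilityMeasure P] {X Y : Ω → ℝ}
    (hX : Measurable X) (hY : Measurable Y) [NullSingletonClass (P.map X)] {a : ℝ} (ha : 0 < a) (b : ℝ) :
    ∫⁻ ω, ENNReal.ofReal ((a * X ω + b - otMap1d (P.map X) (P.map Y) (X ω)) ^ 2) ∂P ≤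
      ∫⁻ ω, ENNReal.ofReal ((a * X ω + b - Y ω) ^ 2) ∂P := by
  have := Measure.isProbabilityMeasure_map (μ := P) hX.aemeasurable
  have := Measure.isProbabilityMeasure_map (μ := P) hY.aemeasurable
  have hm := (aemeasurable_otMap1d (P.map X) (P.map Y)).comp_measurable hX
  have hcdf := monotone_cdf (P.map X)
  have hset : ∀ t, {ω | hm.mk _ ω ≤ t} =ᵐ[P]
      X ⁻¹' {x | cdf (P.map X) x ≤ cdf (P.map Y) t} := fun t => by
    filter_upwards [hm.ae_eq_mk, ae_of_ae_map hX.aemeasurable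
      (ae_otMap1d_le_iff (P.map X) (P.map Y))] with ω h₁ h₂
    apply propext
    change hm.mk _ ω ≤ t ↔ cdf (P.map X) (X ω) ≤ cdf (P.map Y) t
    rw [← h₁]
    exact h₂ t
  have hlow : ∀ r, IsLowerSet {x | cdf (P.map X) x ≤ r} := fun r x y hyx hx =>
    (hcdf hyx).trans hx
  have hlow' : ∀ s, IsLowerSet {x : ℝ | a * x + b ≤ s} := fun s x y hyx hx => by
    have hx' : a * x + b ≤ s := hx
    have := mul_le_mul_of_nonneg_left hyx ha.le
    change a * y + b ≤ s
    linarith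
  have key := lintegral_sub_sq_le_of_comonotone P (U := fun ω => a * X ω + b)
    (by fun_prop) hm.measurable_mk hY
    (fun s t => by
      rw [measure_congr ((ae_eq_refl _).diff (hset t)), measure_congr (hset t)]
      exact measure_diff_le_of_isLowerSet P hX (hlow' s) (hlow _))
    (fun s t => by
      rw [measure_congr ((hset s).diff (ae_eq_refl {ω | a * X ω + b ≤ t})),
        measure_congr (hset s)]
      exact measure_diff_le_of_isLowerSet P hX (hlow _) (hlow' t))
    (fun t => by
      have hm' : MeasurableSet {x | cdf (P.map X) x ≤ cdf (P.map Y) t} :=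
        hcdf.measurable measurableSet_Iic
      rw [measure_congr (hset t), ← Measure.map_apply hX hm',
        measure_cdf_le, ← measure_Iic_eq_ofReal_cdf, Measure.map_apply hY measurableSet_Iic]
      · rfl
      · exact ⟨ENNReal.toReal_nonneg, by
          simpa only [cdf_eq_probabilityTheory_cdf] using ProbabilityTheory.cdf_le_one _ t⟩)
  refine (lintegral_congr_ae ?_).trans_le key
  filter_upwards [hm.ae_eq_mk] with ω h
  rw [← h]
  rfl

lemma noAtoms_slice {n : ℕ} (σ : Measure (Rn n)) (hac : σ ≪ volume) {v : Rn n} (hv : v ≠ 0) :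
    NullSingletonClass (slice σ v) := by
  have hmeas : Measurable fun x : Rn n => (⟪x, v⟫ : ℝ) := by fun_prop
  refine ⟨fun t => ?_⟩
  rw [slice, Measure.map_apply hmeas (measurableSet_singleton t)]
  apply hac
  have hsurj : Function.Surjective (innerₛₗ ℝ v : Rn n →ₗ[ℝ] ℝ) := fun r => by
    refine ⟨(r / ⟪v, v⟫) • v, ?_⟩
    simp only [innerₛₗ_apply_apply, real_inner_smul_right]
    exact div_mul_cancel₀ _ (inner_self_ne_zero.2 hv)
  have h := (ae_comp_linearMap_mem_iff (innerₛₗ ℝ v : Rn n →ₗ[ℝ] ℝ) volume volume hsurj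
    (measurableSet_singleton t).compl).2 (by simp [ae_iff])
  rw [ae_iff] at h
  simpa [Set.preimage, real_inner_comm] using h

lemma eLpNorm_two_sq {E : Type*} [NormedAddCommGroup E] (P : Measure Ω) (f : Ω → E) :
    eLpNorm f 2 P ^ 2 = ∫⁻ ω, ENNReal.ofReal (‖f ω‖ ^ 2) ∂P := by
  have := eLpNorm_nnreal_pow_eq_lintegral (f := f) (μ := P) (p := 2) two_ne_zero
  simpa [ENNReal.ofReal_pow] using this

lemma sqrt_integral_norm_sq {E : Type*} [NormedAddCommGroup E] (P : Measure Ω) {f : Ω → E}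
    (hf : AEStronglyMeasurable f P) :
    Real.sqrt (∫ ω, ‖f ω‖ ^ 2 ∂P) = (eLpNorm f 2 P).toReal := by
  rw [toReal_eLpNorm hf, lpNorm_eq_integral_norm_rpow_toReal two_ne_zero ENNReal.ofNat_ne_top hf,
    Real.sqrt_eq_rpow]
  simp

lemma eLpNorm_two_sq_eq_sum_inner {n : ℕ} (b : OrthonormalBasis (Fin n) ℝ (Rn n))
    (P : Measure Ω) {f : Ω → Rn n} (hf : AEStronglyMeasurable f P) :
    eLpNorm f 2 P ^ 2 = ∑ i, ∫⁻ ω, ENNReal.ofReal (⟪f ω, b i⟫ ^ 2) ∂P := by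
  rw [eLpNorm_two_sq, ← lintegral_finsetSum']
  · refine lintegral_congr fun ω => ?_
    rw [← ENNReal.ofReal_sum_of_nonneg fun i _ => sq_nonneg _, ← b.sum_sq_norm_inner_left (f ω)]
    simp
  · intro i _
    have := (hf.inner (𝕜 := ℝ) (aestronglyMeasurable_const (b := b i))).aemeasurable
    fun_prop

lemma inner_smMap {n : ℕ} (σ μ : Measure (Rn n)) {θ : Fin n → Rn n} (hθ : Orthonormal ℝ θ)
    (x : Rn n) (i : Fin n) :
    (⟪smMap σ μ θ x, θ i⟫ : ℝ) = otMap1d (slice σ (θ i)) (slice μ (θ i)) ⟪x, θ i⟫ := by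
  simpa [smMap] using hθ.inner_left_fintype
    (fun i => otMap1d (slice σ (θ i)) (slice μ (θ i)) ⟪x, θ i⟫) i

/-- For any map `T` with `μ = T_♯σ`, the matrix-slice matching map is
within twice the distance from `T` to the set of translations-and-isotropic-scalings. -/
theorem stmt10 {n : ℕ}
    (σ : Measure (Rn n)) [IsProbabilityMeasure σ] (hac : σ ≪ volume)
    (hσ2 : Integrable (fun x => ‖x‖ ^ 2) σ)
    (T : Rn n → Rn n) (hTmeas : Measurable T)
    (hT2 : Integrable (fun x => ‖T x‖ ^ 2) σ)
    (μ : Measure (Rn n)) (hμ : μ = σ.map T)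
    (θ : Fin n → Rn n) (hθ : Orthonormal ℝ θ) :
    Real.sqrt (∫ x, ‖T x - smMap σ μ θ x‖ ^ 2 ∂σ) ≤
      2 * sInf {r : ℝ | ∃ a : ℝ, 0 < a ∧ ∃ b : Rn n,
        r = Real.sqrt (∫ x, ‖T x - (a • x + b)‖ ^ 2 ∂σ)} := by
  subst hμ
  let B : OrthonormalBasis (Fin n) ℝ (Rn n) := OrthonormalBasis.mk hθ
    (hθ.linearIndependent.span_eq_top_of_card_eq_finrank' (by simp)).ge
  have hB : ⇑B = θ := OrthonormalBasis.coe_mk _ _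
  have hinner : ∀ i, Measurable fun x : Rn n => (⟪x, θ i⟫ : ℝ) := fun i => by fun_prop
  have hatoms : ∀ i, NullSingletonClass (slice σ (θ i)) := fun i => noAtoms_slice σ hac (hθ.ne_zero i)
  have hslice : ∀ i, slice (σ.map T) (θ i) = σ.map fun x => (⟪T x, θ i⟫ : ℝ) := fun i =>
    Measure.map_map (hinner i) hTmeas
  have hprob : ∀ i, IsProbabilityMeasure (slice σ (θ i)) := fun i =>
    Measure.isProbabilityMeasure_map (hinner i).aemeasurable
  have hprob' : ∀ i, IsProbabilityMeasure (slice (σ.map T) (θ i)) := fun i => by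
    rw [hslice]
    exact Measure.isProbabilityMeasure_map ((hinner i).comp hTmeas).aemeasurable
  have hS : AEStronglyMeasurable (smMap σ (σ.map T) θ) σ := by
    refine AEMeasurable.aestronglyMeasurable ?_
    have : ∀ i, AEMeasurable (fun x => otMap1d (slice σ (θ i)) (slice (σ.map T) (θ i)) ⟪x, θ i⟫)
        σ := fun i =>
      (aemeasurable_otMap1d (slice σ (θ i)) (slice (σ.map T) (θ i))).comp_measurable (hinner i)
    unfold smMap
    fun_prop
  have hTm : AEStronglyMeasurable T σ := hTmeas.aestronglyMeasurable
  have hTL : MemLp T 2 σ := (memLp_two_iff_integrable_sq_norm hTm).2 hT2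
  have hid : MemLp (fun x : Rn n => x) 2 σ :=
    (memLp_two_iff_integrable_sq_norm (by fun_prop)).2 hσ2
  suffices h : Real.sqrt (∫ x, ‖T x - smMap σ (σ.map T) θ x‖ ^ 2 ∂σ) / 2 ≤
      sInf {r : ℝ | ∃ a : ℝ, 0 < a ∧ ∃ b : Rn n,
        r = Real.sqrt (∫ x, ‖T x - (a • x + b)‖ ^ 2 ∂σ)} by linarith
  refine le_csInf ⟨_, 1, one_pos, 0, rfl⟩ ?_
  rintro _ ⟨a, ha, b, rfl⟩
  have hL : MemLp (fun x : Rn n => a • x + b) 2 σ := (hid.const_smul a).add (memLp_const b)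
  have hTL' : MemLp (fun x => T x - (a • x + b)) 2 σ := hTL.sub hL
  have hSL : AEStronglyMeasurable (fun x => (a • x + b) - smMap σ (σ.map T) θ x) σ := hL.1.sub hS
  have hTS : AEStronglyMeasurable (fun x => T x - smMap σ (σ.map T) θ x) σ := hTm.sub hS
  have hLS : eLpNorm (fun x => (a • x + b) - smMap σ (σ.map T) θ x) 2 σ ≤
      eLpNorm (fun x => T x - (a • x + b)) 2 σ := by
    rw [← ENNReal.pow_le_pow_left_iff two_ne_zero,
      eLpNorm_two_sq_eq_sum_inner B σ hSL, eLpNorm_two_sq_eq_sum_inner B σ hTL'.1, hB]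
    refine Finset.sum_le_sum fun i _ => ?_
    have : NullSingletonClass (σ.map fun x : Rn n => (⟪x, θ i⟫ : ℝ)) := hatoms i
    have key := lintegral_affine_sub_otMap1d_sq_le σ (hinner i) ((hinner i).comp hTmeas) ha
      ⟪b, θ i⟫
    refine (lintegral_congr fun x => ?_).trans_le
      (key.trans_eq (lintegral_congr fun x => ?_))
    · rw [inner_sub_left, inner_smMap _ _ hθ, inner_add_left, real_inner_smul_left, hslice]
      rfl
    · rw [inner_sub_left (T x), inner_add_left, real_inner_smul_left, Function.comp_apply]
      congr 1
      ring
  rw [sqrt_integral_norm_sq σ hTS, sqrt_integral_norm_sq σ hTL'.1, div_le_iff₀ two_pos,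
    mul_two, ← ENNReal.toReal_add hTL'.2.ne hTL'.2.ne]
  refine ENNReal.toReal_mono (ENNReal.add_ne_top.2 ⟨hTL'.2.ne, hTL'.2.ne⟩) ?_
  calc eLpNorm (fun x => T x - smMap σ (σ.map T) θ x) 2 σ
      = eLpNorm ((fun x => T x - (a • x + b)) +
          fun x => (a • x + b) - smMap σ (σ.map T) θ x) 2 σ := by
        congr 1
        ext1 x
        simp
    _ ≤ _ := eLpNorm_add_le hTL'.1 hSL one_le_two
    _ ≤ _ := by gcongr

end SliceMatching
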